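/- Let F : ℕ → ℝ≥0 satisfy F(n) ≤ F(n_A) + F(n_B) + K·n·log n for all n > n_0, where n_A + n_B ≤ n + β√n and (1−α)n ≤ n_A, n_B ≤ αn + β√n for constants 1/2 < α < 1, β > 0, K > 0, and F(n) = O(1) for n ≤ n_0 (with n_0 chosen large enough that αn + β√n ≤ α(1+ε)n for some ε with α(1+ε) < 1). Then F(n) = O(n log² n); more precisely there exist constants k_0, k_1, k_2 such that F(n) ≤ k_0 n + k_1 n log n + k_2 n log² n for all n. -/

import Mathlib

/-- For large `x`, the quantity `1 + log² x` is at most any fixed positive multiple of `√x`. -/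
lemma eventually_one_add_log_sq_le_mul_sqrt {c : ℝ} (hc : 0 < c) :
    ∀ᶠ x : ℝ in Filter.atTop, 1 + Real.log x ^ 2 ≤ c * Real.sqrt x := by
  have hlog : (fun x : ℝ => Real.log x ^ 2) =o[Filter.atTop] Real.sqrt := by
    have h := isLittleO_log_rpow_rpow_atTop (2 : ℝ) (show (0 : ℝ) < 1 / 2 by norm_num)
    exact (h.congr_left fun x => Real.rpow_two _).congr_right fun x => (Real.sqrt_eq_rpow x).symm
  have hone : (fun _ : ℝ => (1 : ℝ)) =o[Filter.atTop] Real.sqrt :=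
    Asymptotics.isLittleO_const_left.2 <| Or.inr <|
      Filter.tendsto_abs_atTop_atTop.comp Real.tendsto_sqrt_atTop
  filter_upwards [(hone.add hlog).bound hc] with x hx
  rwa [Real.norm_of_nonneg (by positivity), Real.norm_of_nonneg (Real.sqrt_nonneg x)] at hx

/-- If `1 ≤ m ≤ exp (-d) * n` then `m (1 + log² m) ≤ m (1 + (log n - d)²)`. -/
lemma mul_one_add_log_sq_le {m n d : ℝ} (hm : 1 ≤ m) (hn : 0 < n)
    (hmn : m ≤ Real.exp (-d) * n) :
    m * (1 + Real.log m ^ 2) ≤ m * (1 + (Real.log n - d) ^ 2) := by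
  have hlog : Real.log m ≤ Real.log n - d := by
    have h := Real.log_le_log (by linarith) hmn
    rw [Real.log_mul (Real.exp_ne_zero _) hn.ne', Real.log_exp] at h
    linarith
  have h0 := Real.log_nonneg hm
  gcongr


/-- The separator recurrence `F(n) ≤ F(n_A) + F(n_B) + K n log n` with subproblem
sizes `n_A + n_B ≤ n + β√n` and `(1−α)n ≤ n_A, n_B ≤ αn + β√n` (for `1/2 < α < 1`,
`β, K > 0`, base case `F(n) ≤ C_b` for `n ≤ n₀`, and `n₀` large enough that
`αn + β√n ≤ α(1+ε)n` with `α(1+ε) < 1`) has solution `F(n) = O(n log² n)`. -/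
theorem separator_recurrence_nlog2n (F : ℕ → ℝ) (hF0 : ∀ n, 0 ≤ F n)
    (α β K ε Cb : ℝ) (n₀ : ℕ)
    (hα1 : 1 / 2 < α) (hα2 : α < 1) (hβ : 0 < β) (hK : 0 < K)
    (hε : 0 < ε) (hαε : α * (1 + ε) < 1)
    (hn₀ : ∀ n : ℕ, n₀ < n → α * n + β * Real.sqrt n ≤ α * (1 + ε) * n)
    (hbase : ∀ n : ℕ, n ≤ n₀ → F n ≤ Cb)
    (hrec : ∀ n : ℕ, n₀ < n → ∃ nA nB : ℕ,
      (nA : ℝ) + nB ≤ n + β * Real.sqrt n ∧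
      (1 - α) * n ≤ nA ∧ (nA : ℝ) ≤ α * n + β * Real.sqrt n ∧
      (1 - α) * n ≤ nB ∧ (nB : ℝ) ≤ α * n + β * Real.sqrt n ∧
      F n ≤ F nA + F nB + K * n * Real.log n) :
    ∃ k₀ k₁ k₂ : ℝ, ∀ n : ℕ, 1 ≤ n →
      F n ≤ k₀ * n + k₁ * n * Real.log n + k₂ * n * (Real.log n) ^ 2 := by
  set d : ℝ := -Real.log (α * (1 + ε)) with hd
  have hc : 0 < α * (1 + ε) := by positivity
  have hd0 : 0 < d := neg_pos.2 (Real.log_neg hc hαε)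
  have hexp : Real.exp (-d) = α * (1 + ε) := by rw [hd, neg_neg, Real.exp_log hc]
  obtain ⟨N, hN⟩ : ∃ N : ℕ, ∀ n : ℕ, N ≤ n → n₀ < n ∧ d ≤ Real.log n ∧
      1 + Real.log n ^ 2 ≤ d ^ 2 / (2 * β) * Real.sqrt n := by
    refine Filter.eventually_atTop.1 ?_
    have hcast := tendsto_natCast_atTop_atTop (R := ℝ)
    exact (Filter.eventually_gt_atTop n₀).and
      (((Real.tendsto_log_atTop.comp hcast).eventually_ge_atTop d).and
        (hcast.eventually (eventually_one_add_log_sq_le_mul_sqrt (by positivity))))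
  set b : ℝ := max (∑ i ∈ Finset.range N, F i) (2 * K / d) with hb
  have hKb : K ≤ b * d / 2 := by
    have h : 2 * K / d ≤ b := le_max_right _ _
    rw [div_le_iff₀ hd0] at h
    linarith
  have hb0 : 0 < b := lt_of_lt_of_le (by positivity) (le_max_right _ _)
  have key : ∀ n : ℕ, 1 ≤ n → F n ≤ b * (n * (1 + Real.log n ^ 2)) := by
    intro n
    induction n using Nat.strong_induction_on with
    | _ n ih =>
      intro hn
      have hn1 : (1 : ℝ) ≤ n := by exact_mod_cast hn
      have hn0 : (0 : ℝ) < n := by linarith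
      rcases lt_or_ge n N with hnN | hnN
      · have hFb : F n ≤ b :=
          (Finset.single_le_sum (fun i _ => hF0 i) (Finset.mem_range.2 hnN)).trans
            (le_max_left _ _)
        refine hFb.trans (le_mul_of_one_le_right hb0.le ?_)
        nlinarith [sq_nonneg (Real.log n)]
      · obtain ⟨hnn₀, hdL, hsmall⟩ := hN n hnN
        obtain ⟨nA, nB, hsum, hA1, hA2, hB1, hB2, hF⟩ := hrec n hnn₀
        have hle := hn₀ n hnn₀
        have part : ∀ m : ℕ, (1 - α) * n ≤ m → (m : ℝ) ≤ α * n + β * Real.sqrt n →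
            F m ≤ b * (m * (1 + (Real.log n - d) ^ 2)) := by
          intro m hm1 hm2
          have hm0 : (0 : ℝ) < m := lt_of_lt_of_le (mul_pos (by linarith) hn0) hm1
          have hm : 1 ≤ m := by exact_mod_cast hm0
          have hmn : (m : ℝ) < n := by nlinarith
          refine (ih m (by exact_mod_cast hmn) hm).trans ?_
          gcongr b * ?_
          exact mul_one_add_log_sq_le (by exact_mod_cast hm) hn0 (by rw [hexp]; linarith)
        have hFA := part nA hA1 hA2
        have hFB := part nB hB1 hB2
        set L := Real.log n
        set s := Real.sqrt n
        have hs : s * s = n := Real.mul_self_sqrt hn0.le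
        have hs0 : 0 ≤ s := Real.sqrt_nonneg _
        have hover : β * s * (1 + (L - d) ^ 2) ≤ n * (d ^ 2 / 2) := by
          calc β * s * (1 + (L - d) ^ 2) ≤ β * s * (1 + L ^ 2) := by
                gcongr
                linarith
            _ ≤ β * s * (d ^ 2 / (2 * β) * s) := by gcongr
            _ = s * s * (d ^ 2 / 2) := by field_simp
            _ = n * (d ^ 2 / 2) := by rw [hs]
        have htotal : (nA + nB : ℝ) * (1 + (L - d) ^ 2) ≤
            n * (1 + (L - d) ^ 2) + n * (d ^ 2 / 2) := by
          calc (nA + nB : ℝ) * (1 + (L - d) ^ 2) ≤ (n + β * s) * (1 + (L - d) ^ 2) := by gcongr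
            _ ≤ _ := by linarith
        have hL0 : 0 ≤ L := by linarith
        calc F n ≤ F nA + F nB + K * n * L := hF
          _ ≤ b * ((nA + nB : ℝ) * (1 + (L - d) ^ 2)) + b * d / 2 * n * L := by
              have : K * n * L ≤ b * d / 2 * n * L := by gcongr
              linarith
          _ ≤ b * (n * (1 + (L - d) ^ 2) + n * (d ^ 2 / 2)) + b * d / 2 * n * L := by gcongr
          _ = b * (n * (1 + L ^ 2)) - 3 / 2 * (b * n * d) * (L - d) := by ring
          _ ≤ b * (n * (1 + L ^ 2)) :=
              sub_le_self _ (mul_nonneg (by positivity) (sub_nonneg.2 hdL))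
  refine ⟨b, 0, b, fun n hn => (key n hn).trans_eq ?_⟩
  ring
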